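/- Let h ∈ ℕ₊ and m ∈ ℕ. There exists a constant C = C(d, σ, h, m) > 0 such that for all τ, μ ∈ (0,1] and every continuous function V : ℝ^d × (ℝ^d)^m → ℝ with ‖V‖_{𝒱^m} < ∞, the rescaled function 𝐙_τ V defined by 𝐙_τ V(x; y_1, …, y_m) := τ^{−dm} V(x; x + (y_1 − x)/τ, …, x + (y_m − x)/τ) satisfies ‖K_μ^{*2h, ⊗(1+m)} ∗ 𝐙_τ V‖_{𝒱^m} ≤ C ‖K_μ^{*h, ⊗(1+m)} ∗ V‖_{𝒱^m}, where K_μ^{*g, ⊗(1+m)} ∗ V denotes the convolution of V with the kernel K_μ^{*g} separately in each of its 1+m ℝ^d-valued arguments. -/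

import Mathlib

open MeasureTheory ENNReal Real

/-- The kernel `K_μ` (density, valued in `[0,∞]`). -/
noncomputable def Kker (d : ℕ) (σ μ : ℝ) (x : Fin d → ℝ) : ℝ≥0∞ :=
  ∫⁻ t in Set.Ioi (0 : ℝ), ENNReal.ofReal
    (Real.exp (-t) * (4 * π * t * μ ^ ((2 : ℝ) / σ)) ^ (-(d : ℝ) / 2) *
      Real.exp (-(∑ i, x i ^ 2) / (4 * t * μ ^ ((2 : ℝ) / σ))))

/-- Density of the convolution power `K_μ^{*(n+1)}`. -/
noncomputable def kdens (d : ℕ) (σ μ : ℝ) : ℕ → (Fin d → ℝ) → ℝ≥0∞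
  | 0 => Kker d σ μ
  | n + 1 => fun x => ∫⁻ z, Kker d σ μ z * kdens d σ μ n (x - z)

/-- The real-valued density of `K_μ^{*h}` for `h ≥ 1`. -/
noncomputable def kdR (d : ℕ) (σ μ : ℝ) (h : ℕ) (x : Fin d → ℝ) : ℝ :=
  (kdens d σ μ (h - 1) x).toReal

/-- The norm `‖V‖_{𝒱^m} := sup_x ∫_{(ℝ^d)^m} |V(x; y₁,…,y_m)| dy`, valued in `ℝ≥0∞`. -/
noncomputable def Vnorm (d m : ℕ) (V : (Fin d → ℝ) → (Fin m → Fin d → ℝ) → ℝ) : ℝ≥0∞ :=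
  ⨆ x : Fin d → ℝ, ∫⁻ y : Fin m → Fin d → ℝ, (‖V x y‖₊ : ℝ≥0∞)

/-- The tensorized convolution `K_μ^{*g,⊗(1+m)} ∗ V` (convolution with `K_μ^{*g}`
separately in each of the `1+m` arguments), for `g ≥ 1`. -/
noncomputable def tensConv (d : ℕ) (σ μ : ℝ) (g m : ℕ)
    (V : (Fin d → ℝ) → (Fin m → Fin d → ℝ) → ℝ) :
    (Fin d → ℝ) → (Fin m → Fin d → ℝ) → ℝ :=
  fun x y => ∫ p : (Fin d → ℝ) × (Fin m → Fin d → ℝ),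
    kdR d σ μ g (x - p.1) * (∏ j, kdR d σ μ g (y j - p.2 j)) * V p.1 p.2

/-- The rescaling map `𝐙_τ V(x;y₁,…,y_m) := τ^{−dm} V(x; x+(y₁−x)/τ, …, x+(y_m−x)/τ)`. -/
noncomputable def Zresc (d m : ℕ) (τ : ℝ) (V : (Fin d → ℝ) → (Fin m → Fin d → ℝ) → ℝ) :
    (Fin d → ℝ) → (Fin m → Fin d → ℝ) → ℝ :=
  fun x y => τ ^ (-((d * m : ℕ) : ℝ)) * V x (fun j i => x i + (y j i - x i) / τ)

section UniformFourierStieltjes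

lemma conv_univ {E : Type*} [AddMonoid E] [MeasurableSpace E] [MeasurableAdd₂ E]
    (M N : Measure E) [SFinite M] [SFinite N] :
    (M ∗ N) Set.univ = M Set.univ * N Set.univ := by
  rw [Measure.conv, Measure.map_apply (by fun_prop) MeasurableSet.univ, Set.preimage_univ,
    ← Set.univ_prod_univ, Measure.prod_prod]

variable {ι E F : Type*} [NormedAddCommGroup E] [NormedSpace ℝ E] [MeasurableSpace E]
  [NormedAddCommGroup F] [NormedSpace ℝ F] [MeasurableSpace F]

/-- A family of functions on the dual of `E` is uniformly Fourier–Stieltjes if each member is a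
difference of characteristic functions of two finite measures whose masses are bounded
uniformly over the family. -/
def UniformFourierStieltjes (f : ι → StrongDual ℝ E → ℂ) : Prop :=
  ∃ C : NNReal, ∀ i, ∃ M N : Measure E, IsFiniteMeasure M ∧ IsFiniteMeasure N ∧
    M Set.univ + N Set.univ ≤ C ∧ ∀ L, f i L = charFunDual M L - charFunDual N L

lemma charFunDual_add_measure (M N : Measure E) [IsFiniteMeasure M] [IsFiniteMeasure N]
    [OpensMeasurableSpace E] (L : StrongDual ℝ E) :
    charFunDual (M + N) L = charFunDual M L + charFunDual N L := by
  have h : ∀ P : Measure E, IsFiniteMeasure P →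
      Integrable (fun v => Complex.exp (L v * Complex.I)) P := fun P _ =>
    (integrable_const (1 : ℝ)).mono
      (by have := L.continuous; exact (by fun_prop : Continuous _).measurable.aestronglyMeasurable)
      (by simp [Complex.norm_exp_ofReal_mul_I])
  simp only [charFunDual_apply]
  exact integral_add_measure (h M inferInstance) (h N inferInstance)

namespace UniformFourierStieltjes

variable {f g : ι → StrongDual ℝ E → ℂ}

lemma one [BorelSpace E] : UniformFourierStieltjes (fun (_ : ι) (_ : StrongDual ℝ E) => 1) :=
  ⟨1, fun _ => ⟨Measure.dirac 0, 0, inferInstance, inferInstance, by simp,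
    fun L => by simp [charFunDual_apply]⟩⟩

lemma add [BorelSpace E] (hf : UniformFourierStieltjes f) (hg : UniformFourierStieltjes g) :
    UniformFourierStieltjes (fun i L => f i L + g i L) := by
  obtain ⟨C, hC⟩ := hf
  obtain ⟨D, hD⟩ := hg
  refine ⟨C + D, fun i => ?_⟩
  obtain ⟨M, N, _, _, hm, h⟩ := hC i
  obtain ⟨M', N', _, _, hm', h'⟩ := hD i
  refine ⟨M + M', N + N', inferInstance, inferInstance, ?_, fun L => ?_⟩
  · calc (M + M') Set.univ + (N + N') Set.univ
        = (M Set.univ + N Set.univ) + (M' Set.univ + N' Set.univ) := by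
          simp only [Measure.add_apply]; ring
      _ ≤ _ := by rw [ENNReal.coe_add]; exact add_le_add hm hm'
  · simp only [h, h', charFunDual_add_measure]; ring

lemma const_mul (hf : UniformFourierStieltjes f) (c : ι → ℝ) (B : NNReal) (hc : ∀ i, |c i| ≤ B) :
    UniformFourierStieltjes (fun i L => (c i : ℂ) * f i L) := by
  obtain ⟨C, hC⟩ := hf
  refine ⟨B * C, fun i => ?_⟩
  obtain ⟨M, N, _, _, hm, h⟩ := hC i
  have key : ∀ (s : NNReal) (P : Measure E) (L : StrongDual ℝ E),
      charFunDual (s • P) L = (s : ℝ) * charFunDual P L := fun s P L => by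
    simp only [charFunDual_apply, integral_smul_nnreal_measure]
    simp [NNReal.smul_def]
  have hmass : ∀ s : NNReal, s ≤ B → (s • M) Set.univ + (s • N) Set.univ ≤ (B * C : NNReal) := by
    intro s hs
    simp only [Measure.smul_apply, ENNReal.smul_def, smul_eq_mul]
    rw [← mul_add, ENNReal.coe_mul]
    exact mul_le_mul' (by exact_mod_cast hs) hm
  rcases le_total 0 (c i) with h0 | h0
  · refine ⟨(c i).toNNReal • M, (c i).toNNReal • N, inferInstance, inferInstance, hmass _ ?_,
      fun L => ?_⟩
    · rw [Real.toNNReal_le_iff_le_coe]; exact (le_abs_self _).trans (hc i)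
    · simp only [h, key, Real.coe_toNNReal _ h0]; ring
  · refine ⟨(-c i).toNNReal • N, (-c i).toNNReal • M, inferInstance, inferInstance, ?_,
      fun L => ?_⟩
    · rw [add_comm]
      refine hmass _ ?_
      rw [Real.toNNReal_le_iff_le_coe]; exact (neg_le_abs _).trans (hc i)
    · simp only [h, key, Real.coe_toNNReal _ (by linarith : (0 : ℝ) ≤ -c i)]; push_cast; ring

lemma mul [BorelSpace E] [SecondCountableTopology E] (hf : UniformFourierStieltjes f)
    (hg : UniformFourierStieltjes g) :
    UniformFourierStieltjes (fun i L => f i L * g i L) := by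
  obtain ⟨C, hC⟩ := hf
  obtain ⟨D, hD⟩ := hg
  refine ⟨C * D, fun i => ?_⟩
  obtain ⟨M, N, _, _, hm, h⟩ := hC i
  obtain ⟨M', N', _, _, hm', h'⟩ := hD i
  refine ⟨M ∗ M' + N ∗ N', M ∗ N' + N ∗ M', inferInstance, inferInstance, ?_, fun L => ?_⟩
  · calc (M ∗ M' + N ∗ N') Set.univ + (M ∗ N' + N ∗ M') Set.univ
        = (M Set.univ + N Set.univ) * (M' Set.univ + N' Set.univ) := by
          simp only [Measure.add_apply, conv_univ]; ring
      _ ≤ _ := by rw [ENNReal.coe_mul]; exact mul_le_mul' hm hm'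
  · simp only [h, h', charFunDual_add_measure, charFunDual_conv]
    ring

lemma pow [BorelSpace E] [SecondCountableTopology E] (hf : UniformFourierStieltjes f) (n : ℕ) :
    UniformFourierStieltjes (fun i L => f i L ^ n) := by
  induction n with
  | zero => simpa using one
  | succ n ih => simpa only [pow_succ] using ih.mul hf

lemma finset_prod [BorelSpace E] [SecondCountableTopology E] {κ : Type*} (s : Finset κ)
    {f : κ → ι → StrongDual ℝ E → ℂ} (hf : ∀ k, UniformFourierStieltjes (f k)) :
    UniformFourierStieltjes (fun i L => ∏ k ∈ s, f k i L) := by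
  classical
  induction s using Finset.induction_on with
  | empty => simpa using one
  | insert k s hk ih => simpa only [Finset.prod_insert hk] using (hf k).mul ih

lemma finset_sum [BorelSpace E] {κ : Type*} (s : Finset κ)
    {f : κ → ι → StrongDual ℝ E → ℂ} (hf : ∀ k, UniformFourierStieltjes (f k)) :
    UniformFourierStieltjes (fun i L => ∑ k ∈ s, f k i L) := by
  classical
  induction s using Finset.induction_on with
  | empty => simpa using one.const_mul (fun _ : ι => 0) 0 (by simp)
  | insert k s hk ih => simpa only [Finset.sum_insert hk] using (hf k).add ih

lemma comp [BorelSpace E] [BorelSpace F] {f : StrongDual ℝ F → ℂ}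
    (hf : UniformFourierStieltjes (fun _ : Unit => f)) (A : ι → F →L[ℝ] E) :
    UniformFourierStieltjes (fun i L => f (L.comp (A i))) := by
  obtain ⟨C, hC⟩ := hf
  obtain ⟨M, N, _, _, hm, h⟩ := hC ()
  have hA : ∀ i, Measurable (A i) := fun i => (A i).continuous.measurable
  refine ⟨C, fun i => ⟨M.map (A i), N.map (A i), inferInstance, inferInstance, ?_, fun L => ?_⟩⟩
  · rwa [Measure.map_apply (hA i) .univ, Measure.map_apply (hA i) .univ, Set.preimage_univ]
  · rw [charFunDual_map, charFunDual_map, h]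

end UniformFourierStieltjes

lemma UniformFourierStieltjes.of_integral [BorelSpace E] {Ω : Type*} [MeasurableSpace Ω]
    (P : Measure Ω) {X : Ω → E} (hX : Measurable X) {w : Ω → ℝ} (hw : Measurable w)
    (hint : Integrable w P) :
    UniformFourierStieltjes (fun (_ : Unit) (L : StrongDual ℝ E) =>
      ∫ ω, (w ω : ℂ) * Complex.exp (L (X ω) * Complex.I) ∂P) := by
  have hfin : ∀ v : Ω → ℝ, Integrable v P →
      IsFiniteMeasure (P.withDensity fun ω => ENNReal.ofReal (v ω)) := fun v hv =>
    isFiniteMeasure_withDensity_ofReal hv.2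
  have hneg := hint.neg
  have := hfin w hint
  have := hfin _ hneg
  let M := (P.withDensity fun ω => ENNReal.ofReal (w ω)).map X
  let N := (P.withDensity fun ω => ENNReal.ofReal ((-w) ω)).map X
  have key : ∀ (v : Ω → ℝ), Measurable v → ∀ L : StrongDual ℝ E,
      charFunDual ((P.withDensity fun ω => ENNReal.ofReal (v ω)).map X) L =
        ∫ ω, ((max (v ω) 0 : ℝ) : ℂ) * Complex.exp (L (X ω) * Complex.I) ∂P := by
    intro v hv L
    have := L.continuous
    rw [charFunDual_apply, integral_map hX.aemeasurable
      (by exact (by fun_prop : Continuous _).measurable.aestronglyMeasurable),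
      integral_withDensity_eq_integral_toReal_smul (by fun_prop) (by simp)]
    simp [ENNReal.toReal_ofReal']
  refine ⟨(M Set.univ + N Set.univ).toNNReal, fun _ => ⟨M, N, inferInstance, inferInstance,
    by rw [ENNReal.coe_toNNReal (by finiteness)], fun L => ?_⟩⟩
  have hi : ∀ (v : Ω → ℝ), Integrable v P → Integrable (fun ω =>
      ((max (v ω) 0 : ℝ) : ℂ) * Complex.exp (L (X ω) * Complex.I)) P := fun v hv => by
    have := L.continuous.measurable
    exact hv.pos_part.ofReal.mul_bdd (c := 1)
      (by fun_prop : Measurable fun ω =>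
        Complex.exp (L (X ω) * Complex.I)).aestronglyMeasurable
      (ae_of_all _ fun ω => by simp [Complex.norm_exp_ofReal_mul_I])
  rw [key w hw, key _ hw.neg, ← integral_sub (hi _ hint) (hi _ hneg)]
  refine integral_congr_ae (ae_of_all _ fun ω => ?_)
  simp only
  rw [← sub_mul, ← Complex.ofReal_sub]
  congr 2
  simp only [Pi.neg_apply]
  rcases le_total 0 (w ω) with h | h
  · rw [max_eq_left h, max_eq_right (by linarith)]; ring
  · rw [max_eq_right h, max_eq_left (by linarith)]; ring

end UniformFourierStieltjes

section GaussianMixture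

open ProbabilityTheory

variable {d : ℕ}

/-- The quadratic form `|ξ|²` of a functional `ξ` on `ℝ^d`. -/
noncomputable def dualSq (L : StrongDual ℝ (Fin d → ℝ)) : ℝ := ∑ i, (L (Pi.single i 1)) ^ 2

/-- The symbol `(1 + |ξ|²)⁻¹` of the resolvent of the Laplacian. -/
noncomputable def resolventSymbol (L : StrongDual ℝ (Fin d → ℝ)) : ℂ := ((1 + dualSq L : ℝ) : ℂ)⁻¹

lemma dualSq_nonneg (L : StrongDual ℝ (Fin d → ℝ)) : 0 ≤ dualSq L :=
  Finset.sum_nonneg fun _ _ => sq_nonneg _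

lemma one_add_dualSq_ne_zero (L : StrongDual ℝ (Fin d → ℝ)) : ((1 + dualSq L : ℝ) : ℂ) ≠ 0 := by
  have := dualSq_nonneg L
  exact_mod_cast (by positivity : (1 + dualSq L) ≠ 0)

lemma dualSq_smul (c : ℝ) (L : StrongDual ℝ (Fin d → ℝ)) : dualSq (c • L) = c ^ 2 * dualSq L := by
  simp [dualSq, Finset.mul_sum, mul_pow]

lemma dual_apply_eq_sum (L : StrongDual ℝ (Fin d → ℝ)) (z : Fin d → ℝ) :
    L z = ∑ i, z i * L (Pi.single i 1) := by
  conv_lhs => rw [← Finset.univ_sum_single z]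
  rw [map_sum]
  refine Finset.sum_congr rfl fun i _ => ?_
  rw [← smul_eq_mul, ← map_smul, ← Pi.single_smul', smul_eq_mul, mul_one]

lemma integral_cexp_gaussianReal (c : ℝ) :
    ∫ z, Complex.exp ((z * c : ℝ) * Complex.I) ∂gaussianReal 0 1 = Complex.exp (-(c ^ 2 / 2)) := by
  have h := charFun_gaussianReal (μ := 0) (v := 1) c
  rw [charFun_apply_real] at h
  convert h using 3
  · rw [Complex.ofReal_mul, mul_comm (c : ℂ)]
  · simp

lemma integral_mul_cexp_gaussianReal (c : ℝ) :
    ∫ z, (z : ℂ) * Complex.exp ((z * c : ℝ) * Complex.I) ∂gaussianReal 0 1 =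
      Complex.I * c * Complex.exp (-(c ^ 2 / 2)) := by
  have h := hasDerivAt_complexMGF (X := id) (μ := gaussianReal 0 1) (z := (c : ℂ) * Complex.I)
    (by simp)
  have h2 : HasDerivAt (fun z : ℂ => Complex.exp (z ^ 2 / 2))
      (Complex.exp (((c : ℂ) * Complex.I) ^ 2 / 2) * ((c : ℂ) * Complex.I)) (c * Complex.I) := by
    refine HasDerivAt.cexp ?_
    refine ((hasDerivAt_pow 2 ((c : ℂ) * Complex.I)).div_const 2).congr_deriv ?_
    norm_num
  have hfun : complexMGF id (gaussianReal 0 1) = fun z : ℂ => Complex.exp (z ^ 2 / 2) := by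
    ext z
    rw [complexMGF_id_gaussianReal]
    simp
  rw [hfun] at h
  have := h.unique h2
  calc _ = ∫ z, ((id z : ℝ) : ℂ) * Complex.exp (c * Complex.I * (id z : ℝ)) ∂gaussianReal 0 1 := by
        refine integral_congr_ae (ae_of_all _ fun z => ?_)
        simp only [id]; push_cast; ring_nf
    _ = _ := by
        rw [this]
        rw [mul_pow, Complex.I_sq]
        ring_nf

/-- The standard Gaussian measure on `ℝ^d`. -/
noncomputable def stdGaussianPi (d : ℕ) : Measure (Fin d → ℝ) :=
  Measure.pi fun _ => gaussianReal 0 1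

instance : IsProbabilityMeasure (stdGaussianPi d) := by
  unfold stdGaussianPi; infer_instance

lemma cexp_dual_smul (s : ℝ) (L : StrongDual ℝ (Fin d → ℝ)) (z : Fin d → ℝ) :
    Complex.exp (L (s • z) * Complex.I) =
      ∏ i, Complex.exp ((z i * (s * L (Pi.single i 1)) : ℝ) * Complex.I) := by
  rw [← Complex.exp_sum, dual_apply_eq_sum, ← Finset.sum_mul]
  congr 2
  rw [Complex.ofReal_sum]
  refine Finset.sum_congr rfl fun i _ => ?_
  simp only [Pi.smul_apply, smul_eq_mul]
  push_cast; ring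

lemma prod_cexp_eq (s : ℝ) (L : StrongDual ℝ (Fin d → ℝ)) :
    ∏ i, Complex.exp (-((s * L (Pi.single i 1) : ℝ) ^ 2 / 2)) =
      (Real.exp (-(s ^ 2 / 2 * dualSq L)) : ℂ) := by
  rw [← Complex.exp_sum, Complex.ofReal_exp, dualSq]
  congr 1
  push_cast
  rw [Finset.mul_sum, ← Finset.sum_neg_distrib]
  refine Finset.sum_congr rfl fun i _ => ?_
  ring

lemma integral_cexp_stdGaussianPi (s : ℝ) (L : StrongDual ℝ (Fin d → ℝ)) :
    ∫ z, Complex.exp (L (s • z) * Complex.I) ∂stdGaussianPi d =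
      (Real.exp (-(s ^ 2 / 2 * dualSq L)) : ℂ) := by
  simp_rw [cexp_dual_smul]
  rw [stdGaussianPi, integral_fintype_prod_eq_prod
    (fun i z => Complex.exp ((z * (s * L (Pi.single i 1)) : ℝ) * Complex.I))]
  simp_rw [integral_cexp_gaussianReal]
  exact prod_cexp_eq s L

lemma integral_mul_cexp_stdGaussianPi (s : ℝ) (L : StrongDual ℝ (Fin d → ℝ)) (j : Fin d) :
    ∫ z, (z j : ℂ) * Complex.exp (L (s • z) * Complex.I) ∂stdGaussianPi d =
      Complex.I * (s * L (Pi.single j 1)) * (Real.exp (-(s ^ 2 / 2 * dualSq L)) : ℂ) := by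
  have h : ∀ z : Fin d → ℝ, (z j : ℂ) * Complex.exp (L (s • z) * Complex.I) =
      ∏ i, ((if i = j then (z i : ℂ) else 1) *
        Complex.exp ((z i * (s * L (Pi.single i 1)) : ℝ) * Complex.I)) := fun z => by
    rw [Finset.prod_mul_distrib, cexp_dual_smul, Finset.prod_ite_eq' Finset.univ j]
    simp
  simp_rw [h]
  rw [stdGaussianPi, integral_fintype_prod_eq_prod
    (fun i (z : ℝ) => (if i = j then (z : ℂ) else 1) *
      Complex.exp ((z * (s * L (Pi.single i 1)) : ℝ) * Complex.I))]
  have h2 : ∀ i, (∫ z : ℝ, (if i = j then (z : ℂ) else 1) *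
      Complex.exp ((z * (s * L (Pi.single i 1)) : ℝ) * Complex.I) ∂gaussianReal 0 1) =
      (if i = j then Complex.I * (s * L (Pi.single i 1) : ℝ) else 1) *
        Complex.exp (-((s * L (Pi.single i 1) : ℝ) ^ 2 / 2)) := fun i => by
    split_ifs with hi
    · exact integral_mul_cexp_gaussianReal _
    · simpa using integral_cexp_gaussianReal (s * L (Pi.single i 1))
  simp_rw [h2]
  rw [Finset.prod_mul_distrib, prod_cexp_eq, Finset.prod_ite_eq' Finset.univ j]
  simp

/-- Lebesgue measure on `(0,∞)` times the standard Gaussian measure. -/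
noncomputable def mixtureBase (d : ℕ) : Measure (ℝ × (Fin d → ℝ)) :=
  (volume.restrict (Set.Ioi 0)).prod (stdGaussianPi d)

lemma integral_exp_neg_mul_exp {q : ℝ} (hq : 0 ≤ q) :
    ∫ t in Set.Ioi (0 : ℝ), ((Real.exp (-t) : ℝ) : ℂ) * (Real.exp (-(t * q)) : ℝ) =
      ((1 + q : ℝ) : ℂ)⁻¹ := by
  have h := integral_exp_mul_Ioi (a := -(1 + q)) (by linarith) 0
  rw [mul_zero, Real.exp_zero, neg_div_neg_eq, one_div] at h
  rw [← Complex.ofReal_inv, ← h, ← integral_complex_ofReal]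
  refine integral_congr_ae (ae_of_all _ fun t => ?_)
  simp only
  rw [← Complex.ofReal_mul, ← Real.exp_add]
  ring_nf

lemma integrable_exp_neg : Integrable (fun t : ℝ => Real.exp (-t)) (volume.restrict (Set.Ioi 0)) :=
  integrableOn_exp_neg_Ioi 0

lemma integrable_exp_neg_fst :
    Integrable (fun ω : ℝ × (Fin d → ℝ) => Real.exp (-ω.1)) (mixtureBase d) := by
  simpa [mixtureBase] using integrable_exp_neg.mul_prod
    (integrable_const (μ := stdGaussianPi d) (1 : ℝ))

lemma measurable_smul_sqrt (a : ℝ) :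
    Measurable fun ω : ℝ × (Fin d → ℝ) => √(2 * ω.1 * a) • ω.2 := by
  fun_prop

lemma integrable_mul_cexp {w : ℝ × (Fin d → ℝ) → ℝ} (hw : Integrable w (mixtureBase d)) (a : ℝ)
    (L : StrongDual ℝ (Fin d → ℝ)) :
    Integrable (fun ω => (w ω : ℂ) * Complex.exp (L (√(2 * ω.1 * a) • ω.2) * Complex.I))
      (mixtureBase d) := by
  have := L.continuous.measurable
  have := measurable_smul_sqrt (d := d) a
  exact hw.ofReal.mul_bdd (c := 1)
    (by fun_prop : Measurable fun ω : ℝ × (Fin d → ℝ) =>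
      Complex.exp (L (√(2 * ω.1 * a) • ω.2) * Complex.I)).aestronglyMeasurable
    (ae_of_all _ fun ω => by simp only [Complex.norm_exp_ofReal_mul_I, le_refl])

lemma integral_mixture {a : ℝ} (ha : 0 ≤ a) (L : StrongDual ℝ (Fin d → ℝ)) :
    ∫ ω, ((Real.exp (-ω.1) : ℝ) : ℂ) * Complex.exp (L (√(2 * ω.1 * a) • ω.2) * Complex.I)
      ∂mixtureBase d = resolventSymbol (√a • L) := by
  rw [mixtureBase, integral_prod _ (integrable_mul_cexp integrable_exp_neg_fst a L)]
  simp only [integral_const_mul, integral_cexp_stdGaussianPi]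
  rw [resolventSymbol, dualSq_smul, Real.sq_sqrt ha,
    ← integral_exp_neg_mul_exp (mul_nonneg ha (dualSq_nonneg L))]
  refine setIntegral_congr_fun measurableSet_Ioi fun t (ht : 0 < t) => ?_
  rw [Real.sq_sqrt (by positivity)]
  ring_nf

lemma integral_mixture_deriv (L : StrongDual ℝ (Fin d → ℝ)) (j : Fin d)
    (hint : Integrable (fun ω : ℝ × (Fin d → ℝ) => Real.exp (-ω.1) * (√(2 * ω.1))⁻¹ * ω.2 j)
      (mixtureBase d)) :
    ∫ ω, ((Real.exp (-ω.1) * (√(2 * ω.1))⁻¹ * ω.2 j : ℝ) : ℂ) *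
        Complex.exp (L (√(2 * ω.1) • ω.2) * Complex.I)
      ∂mixtureBase d = Complex.I * L (Pi.single j 1) * resolventSymbol L := by
  have hi := integrable_mul_cexp hint 1 L
  simp only [mul_one] at hi
  rw [mixtureBase, integral_prod _ hi]
  simp only [Complex.ofReal_mul, mul_assoc, integral_const_mul]
  simp only [← mul_assoc, integral_mul_cexp_stdGaussianPi]
  rw [resolventSymbol, ← integral_exp_neg_mul_exp (dualSq_nonneg L), ← integral_const_mul]
  refine setIntegral_congr_fun measurableSet_Ioi fun t (ht : 0 < t) => ?_
  rw [Real.sq_sqrt (by positivity)]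
  have : (√(2 * t) : ℂ) ≠ 0 := by exact_mod_cast (by positivity : √(2 * t) ≠ 0)
  push_cast
  field_simp

lemma integrable_mixture_deriv (j : Fin d) :
    Integrable (fun ω : ℝ × (Fin d → ℝ) => Real.exp (-ω.1) * (√(2 * ω.1))⁻¹ * ω.2 j)
      (mixtureBase d) := by
  refine Integrable.mul_prod (f := fun t : ℝ => Real.exp (-t) * (√(2 * t))⁻¹)
    (g := fun z : Fin d → ℝ => z j) ?_ ?_
  · have h := (Real.GammaIntegral_convergent (s := 1 / 2) (by norm_num)).const_mul (√2)⁻¹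
    refine h.congr ((ae_restrict_iff' measurableSet_Ioi).2 (ae_of_all _ fun t (ht : 0 < t) => ?_))
    simp only
    rw [Real.sqrt_mul (by norm_num), mul_inv, Real.sqrt_eq_rpow t, ← Real.rpow_neg ht.le]
    norm_num
    ring
  · exact integrable_comp_eval (μ := fun _ : Fin d => gaussianReal 0 1) (i := j)
      (f := fun x : ℝ => x) ((memLp_id_gaussianReal 1).integrable le_rfl)

lemma uniformFourierStieltjes_resolventSymbol :
    UniformFourierStieltjes (fun (_ : Unit) => resolventSymbol (d := d)) := by
  have h := UniformFourierStieltjes.of_integral (mixtureBase d)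
    (measurable_smul_sqrt 1) (by fun_prop : Measurable fun ω : ℝ × (Fin d → ℝ) => Real.exp (-ω.1))
    integrable_exp_neg_fst
  simpa only [integral_mixture zero_le_one, Real.sqrt_one, one_smul] using h

lemma uniformFourierStieltjes_deriv (j : Fin d) :
    UniformFourierStieltjes (fun (_ : Unit) (L : StrongDual ℝ (Fin d → ℝ)) =>
      Complex.I * L (Pi.single j 1) * resolventSymbol L) := by
  have h := UniformFourierStieltjes.of_integral (mixtureBase d)
    (measurable_smul_sqrt 1)
    (by fun_prop : Measurable fun ω : ℝ × (Fin d → ℝ) =>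
      Real.exp (-ω.1) * (√(2 * ω.1))⁻¹ * ω.2 j)
    (integrable_mixture_deriv j)
  simpa only [mul_one, integral_mixture_deriv _ j (integrable_mixture_deriv j)] using h

lemma dualSq_mul_resolventSymbol (L : StrongDual ℝ (Fin d → ℝ)) :
    (dualSq L : ℂ) * resolventSymbol L = 1 - resolventSymbol L := by
  have h := one_add_dualSq_ne_zero L
  rw [resolventSymbol]
  field_simp
  push_cast
  ring

lemma uniformFourierStieltjes_dualSq :
    UniformFourierStieltjes (fun (_ : Unit) (L : StrongDual ℝ (Fin d → ℝ)) =>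
      (dualSq L : ℂ) * resolventSymbol L) := by
  simp_rw [dualSq_mul_resolventSymbol]
  have h := UniformFourierStieltjes.one.add
    ((uniformFourierStieltjes_resolventSymbol (d := d)).const_mul (fun _ => -1) 1 (by simp))
  convert h using 3
  push_cast; ring

end GaussianMixture

section Densities

open ProbabilityTheory

lemma lintegral_pi_prod_eq_prod {n : ℕ} {X : Type*} [MeasurableSpace X] {μ : Measure X}
    [SigmaFinite μ] (f : Fin n → X → ℝ≥0∞) (hf : ∀ i, Measurable (f i)) :
    ∫⁻ x : Fin n → X, ∏ i, f i (x i) ∂(Measure.pi fun _ => μ) = ∏ i, ∫⁻ x, f i x ∂μ := by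
  induction n with
  | zero => simp
  | succ n ih =>
    have hm : ∀ i, Measurable fun x : Fin n → X => f (Fin.succ i) (x i) := fun i =>
      (hf _).comp (measurable_pi_apply i)
    calc
      _ = ∫⁻ x : X × (Fin n → X), f 0 x.1 * ∏ i : Fin n, f (Fin.succ i) (x.2 i)
            ∂(μ.prod (Measure.pi (fun _ => μ))) := by
          rw [← ((measurePreserving_piFinSuccAbove (fun _ : Fin (n + 1) => μ)
            0).symm).lintegral_comp_emb (MeasurableEquiv.measurableEmbedding _)]
          simp only [MeasurableEquiv.piFinSuccAbove_symm_apply, Fin.insertNthEquiv,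
            Fin.prod_univ_succ, Fin.insertNth_zero, Equiv.coe_fn_mk, Fin.cons_succ,
            Fin.cons_zero, cast_eq]
      _ = (∫⁻ x, f 0 x ∂μ) * ∏ i : Fin n, ∫⁻ x, f (Fin.succ i) x ∂μ := by
          rw [← ih _ fun i => hf _]
          exact lintegral_prod_mul (hf 0).aemeasurable
            (Finset.measurable_fun_prod _ fun i _ => hm i).aemeasurable
      _ = _ := by rw [Fin.prod_univ_succ]

lemma pi_withDensity_eq {n : ℕ} {X : Type*} [MeasurableSpace X] {μ : Measure X}
    [SigmaFinite μ] {f : X → ℝ≥0∞} (hf : Measurable f) [SigmaFinite (μ.withDensity f)] :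
    Measure.pi (fun _ : Fin n => μ.withDensity f) =
      (Measure.pi fun _ : Fin n => μ).withDensity fun x => ∏ i, f (x i) := by
  refine Measure.pi_eq fun s hs => ?_
  rw [withDensity_apply _ (MeasurableSet.univ_pi hs), ← lintegral_indicator (.univ_pi hs)]
  have h : (Set.univ.pi s).indicator (fun x : Fin n → X => ∏ i, f (x i)) =
      fun x => ∏ i, (s i).indicator f (x i) := by
    ext x
    by_cases hx : x ∈ Set.univ.pi s
    · rw [Set.indicator_of_mem hx]
      exact Finset.prod_congr rfl fun i _ => (Set.indicator_of_mem (hx i trivial) f).symm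
    · rw [Set.indicator_of_notMem hx]
      simp only [Set.mem_univ_pi, not_forall] at hx
      obtain ⟨i, hi⟩ := hx
      exact (Finset.prod_eq_zero (Finset.mem_univ i) (Set.indicator_of_notMem hi f)).symm
  rw [h, lintegral_pi_prod_eq_prod _ fun i => hf.indicator (hs i)]
  exact Finset.prod_congr rfl fun i _ => by
    rw [withDensity_apply _ (hs i), lintegral_indicator (hs i)]

variable {d : ℕ} {σ μ : ℝ}

lemma stdGaussianPi_map_smul {s : ℝ} (hs : 0 < s) :
    (stdGaussianPi d).map (fun z => s • z) = (volume : Measure (Fin d → ℝ)).withDensity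
      fun x => ∏ i, gaussianPDF 0 (s ^ 2).toNNReal (x i) := by
  have hv : (s ^ 2).toNNReal ≠ 0 := by simpa using hs.ne'
  have : SigmaFinite ((volume : Measure ℝ).withDensity (gaussianPDF 0 (s ^ 2).toNNReal)) := by
    rw [← gaussianReal_of_var_ne_zero _ hv]; infer_instance
  rw [volume_pi, ← pi_withDensity_eq (measurable_gaussianPDF _ _),
    ← gaussianReal_of_var_ne_zero _ hv, stdGaussianPi]
  have h := Measure.pi_map_pi (μ := fun _ : Fin d => gaussianReal 0 1)
    (f := fun _ (x : ℝ) => s * x) (fun _ => by fun_prop)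
  convert! h using 2
  ext1 i
  rw [gaussianReal_map_const_mul]
  congr 1
  · simp
  · ext; simp [sq_nonneg]

lemma prod_gaussianPDF {t a : ℝ} (ht : 0 < t) (ha : 0 < a) (x : Fin d → ℝ) :
    ENNReal.ofReal (Real.exp (-t)) * ∏ i, gaussianPDF 0 (√(2 * t * a) ^ 2).toNNReal (x i) =
      ENNReal.ofReal (Real.exp (-t) * (4 * π * t * a) ^ (-(d : ℝ) / 2) *
        Real.exp (-(∑ i, x i ^ 2) / (4 * t * a))) := by
  simp only [gaussianPDF, gaussianPDFReal]
  rw [← ENNReal.ofReal_prod_of_nonneg (fun i _ => by positivity),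
    ← ENNReal.ofReal_mul (Real.exp_nonneg _), mul_assoc (Real.exp (-t))]
  congr 2
  rw [Real.sq_sqrt (by positivity), Real.coe_toNNReal _ (by positivity), Finset.prod_mul_distrib,
    ← Real.exp_sum, Finset.prod_const, Finset.card_univ, Fintype.card_fin]
  congr 1
  · rw [Real.sqrt_eq_rpow, ← Real.rpow_neg (by positivity), ← Real.rpow_natCast,
      ← Real.rpow_mul (by positivity)]
    congr 1 <;> ring
  · rw [neg_div, Finset.sum_div, ← Finset.sum_neg_distrib]
    congr 1
    refine Finset.sum_congr rfl fun i _ => ?_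
    rw [sub_zero, neg_div]
    congr 2
    ring

lemma measurable_Kker_integrand (a : ℝ) :
    Measurable fun p : (Fin d → ℝ) × ℝ => ENNReal.ofReal
      (Real.exp (-p.2) * (4 * π * p.2 * a) ^ (-(d : ℝ) / 2) *
        Real.exp (-(∑ i, p.1 i ^ 2) / (4 * p.2 * a))) := by
  fun_prop

lemma measurable_Kker : Measurable (Kker d σ μ) :=
  (measurable_Kker_integrand (μ ^ ((2 : ℝ) / σ))).lintegral_prod_right'

lemma volume_withDensity_Kker (hμ : 0 < μ) :
    volume.withDensity (Kker d σ μ) =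
      ((mixtureBase d).withDensity fun ω => ENNReal.ofReal (Real.exp (-ω.1))).map
        fun ω => √(2 * ω.1 * μ ^ ((2 : ℝ) / σ)) • ω.2 := by
  set a := μ ^ ((2 : ℝ) / σ) with ha_def
  have ha : 0 < a := Real.rpow_pos_of_pos hμ _
  have hX := measurable_smul_sqrt (d := d) a
  refine Measure.ext_of_lintegral _ fun φ hφ => ?_
  rw [lintegral_withDensity_eq_lintegral_mul _ measurable_Kker hφ, lintegral_map hφ hX,
    lintegral_withDensity_eq_lintegral_mul _ (by fun_prop) (by fun_prop),
    mixtureBase, lintegral_prod _ (by fun_prop)]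
  symm
  have h1 : ∀ t ∈ Set.Ioi (0 : ℝ), ∫⁻ z, ((fun ω : ℝ × (Fin d → ℝ) =>
        ENNReal.ofReal (Real.exp (-ω.1))) *
          fun ω : ℝ × (Fin d → ℝ) => φ (√(2 * ω.1 * a) • ω.2)) (t, z)
        ∂stdGaussianPi d =
      ∫⁻ x, ENNReal.ofReal (Real.exp (-t) * (4 * π * t * a) ^ (-(d : ℝ) / 2) *
        Real.exp (-(∑ i, x i ^ 2) / (4 * t * a))) * φ x := by
    intro t (ht : 0 < t)
    simp only [Pi.mul_apply]
    rw [lintegral_const_mul _ (by fun_prop),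
      ← lintegral_map (f := φ) (g := fun z => √(2 * t * a) • z) hφ (by fun_prop),
      stdGaussianPi_map_smul (by positivity),
      lintegral_withDensity_eq_lintegral_mul _ (by fun_prop) hφ,
      ← lintegral_const_mul _ (by fun_prop)]
    refine lintegral_congr fun x => ?_
    rw [Pi.mul_apply, ← mul_assoc, prod_gaussianPDF ht ha]
  rw [setLIntegral_congr_fun measurableSet_Ioi h1, lintegral_lintegral_swap]
  · refine lintegral_congr fun x => ?_
    rw [Pi.mul_apply, lintegral_mul_const _ (by fun_prop)]
    rfl
  · exact (((measurable_Kker_integrand a).comp measurable_swap).mul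
      (hφ.comp measurable_snd)).aemeasurable

lemma charFunDual_withDensity_Kker (hμ : 0 < μ) (L : StrongDual ℝ (Fin d → ℝ)) :
    charFunDual (volume.withDensity (Kker d σ μ)) L =
      resolventSymbol (√(μ ^ ((2 : ℝ) / σ)) • L) := by
  have := L.continuous.measurable
  rw [volume_withDensity_Kker hμ, charFunDual_apply,
    integral_map (measurable_smul_sqrt _).aemeasurable
      (by fun_prop : Measurable fun v => Complex.exp (L v * Complex.I)).aestronglyMeasurable,
    integral_withDensity_eq_integral_toReal_smul (by fun_prop) (by simp),
    ← integral_mixture (Real.rpow_nonneg hμ.le _)]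
  refine integral_congr_ae (ae_of_all _ fun ω => ?_)
  simp [ENNReal.toReal_ofReal (Real.exp_nonneg _)]

lemma isProbabilityMeasure_withDensity_Kker (hμ : 0 < μ) :
    IsProbabilityMeasure (volume.withDensity (Kker d σ μ)) := by
  rw [volume_withDensity_Kker hμ]
  have : IsProbabilityMeasure
      ((mixtureBase d).withDensity fun ω => ENNReal.ofReal (Real.exp (-ω.1))) := by
    refine ⟨?_⟩
    rw [withDensity_apply _ .univ, setLIntegral_univ, mixtureBase, lintegral_prod _ (by fun_prop)]
    simp only [lintegral_const, measure_univ, mul_one]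
    rw [← ofReal_integral_eq_lintegral_ofReal integrable_exp_neg
      (ae_of_all _ fun t => Real.exp_nonneg _), integral_exp_neg_Ioi_zero, ENNReal.ofReal_one]
  exact Measure.isProbabilityMeasure_map (measurable_smul_sqrt _).aemeasurable

lemma measurable_kdens (n : ℕ) : Measurable (kdens d σ μ n) := by
  induction n with
  | zero => exact measurable_Kker
  | succ n ih =>
    have : Measurable fun p : (Fin d → ℝ) × (Fin d → ℝ) =>
        Kker d σ μ p.2 * kdens d σ μ n (p.1 - p.2) :=
      (measurable_Kker.comp measurable_snd).mul (ih.comp (measurable_fst.sub measurable_snd))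
    exact this.lintegral_prod_right'

lemma withDensity_kdens_succ (n : ℕ) :
    volume.withDensity (kdens d σ μ (n + 1)) =
      volume.withDensity (Kker d σ μ) ∗ volume.withDensity (kdens d σ μ n) := by
  rw [conv_withDensity_eq_lconvolution measurable_Kker (measurable_kdens n)]
  congr 1
  ext x
  simp [kdens, lconvolution_def, sub_eq_neg_add]

lemma isProbabilityMeasure_withDensity_kdens (hμ : 0 < μ) (n : ℕ) :
    IsProbabilityMeasure (volume.withDensity (kdens d σ μ n)) := by
  have := isProbabilityMeasure_withDensity_Kker (d := d) (σ := σ) hμ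
  induction n with
  | zero => exact this
  | succ n ih => rw [withDensity_kdens_succ]; infer_instance

lemma charFunDual_withDensity_kdens (hμ : 0 < μ) (n : ℕ) (L : StrongDual ℝ (Fin d → ℝ)) :
    charFunDual (volume.withDensity (kdens d σ μ n)) L =
      resolventSymbol (√(μ ^ ((2 : ℝ) / σ)) • L) ^ (n + 1) := by
  have := isProbabilityMeasure_withDensity_Kker (d := d) (σ := σ) hμ
  induction n with
  | zero => simpa [kdens] using charFunDual_withDensity_Kker hμ L
  | succ n ih =>
    have := isProbabilityMeasure_withDensity_kdens (d := d) (σ := σ) hμ n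
    rw [withDensity_kdens_succ, charFunDual_conv, ih, charFunDual_withDensity_Kker hμ,
      pow_succ' _ (n + 1)]

/-- The measure with density `K_μ^{*(n+1),⊗(1+m)}`. -/
noncomputable def tensMeasure (d : ℕ) (σ μ : ℝ) (n m : ℕ) :
    Measure ((Fin d → ℝ) × (Fin m → Fin d → ℝ)) :=
  (volume.withDensity (kdens d σ μ n)).prod
    (Measure.pi fun _ : Fin m => volume.withDensity (kdens d σ μ n))

lemma isProbabilityMeasure_tensMeasure (hμ : 0 < μ) (n m : ℕ) :
    IsProbabilityMeasure (tensMeasure d σ μ n m) := by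
  have := isProbabilityMeasure_withDensity_kdens (d := d) (σ := σ) hμ n
  unfold tensMeasure
  infer_instance

instance {m : ℕ} : (volume : Measure (Fin m → Fin d → ℝ)).IsAddHaarMeasure :=
  Measure.pi.isAddHaarMeasure fun _ : Fin m => (volume : Measure (Fin d → ℝ))

instance {m : ℕ} :
    (volume : Measure ((Fin d → ℝ) × (Fin m → Fin d → ℝ))).IsAddLeftInvariant :=
  inferInstanceAs (volume.prod volume : Measure
    ((Fin d → ℝ) × (Fin m → Fin d → ℝ))).IsAddLeftInvariant

instance {m : ℕ} : (volume : Measure ((Fin d → ℝ) × (Fin m → Fin d → ℝ))).IsNegInvariant := by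
  have h := Measure.map_prod_map (volume : Measure (Fin d → ℝ))
    (volume : Measure (Fin m → Fin d → ℝ)) measurable_neg measurable_neg
  have h1 := Measure.map_neg_eq_self (volume : Measure (Fin d → ℝ))
  have h2 := Measure.map_neg_eq_self (volume : Measure (Fin m → Fin d → ℝ))
  refine ⟨?_⟩
  rw [Measure.neg, Measure.volume_eq_prod]
  conv_rhs => rw [← h1, ← h2]
  exact h.symm

lemma tensConv_eq_integral (hμ : 0 < μ) {n m : ℕ} (V : (Fin d → ℝ) → (Fin m → Fin d → ℝ) → ℝ)
    (z : (Fin d → ℝ) × (Fin m → Fin d → ℝ)) :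
    tensConv d σ μ (n + 1) m V z.1 z.2 =
      ∫ p, Function.uncurry V (z - p) ∂tensMeasure d σ μ n m := by
  have hp := isProbabilityMeasure_withDensity_kdens (d := d) (σ := σ) hμ n
  have hk := measurable_kdens (d := d) (σ := σ) (μ := μ) n
  have hfin : ∀ᵐ x, kdens d σ μ n x < ⊤ := by
    refine ae_lt_top hk ?_
    rw [← setLIntegral_univ, ← withDensity_apply _ .univ]
    finiteness
  have hpi : Measurable fun y : Fin m → Fin d → ℝ => ∏ i, kdens d σ μ n (y i) :=
    Finset.measurable_fun_prod _ fun i _ => hk.comp (measurable_pi_apply i)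
  have hdens : tensMeasure d σ μ n m = (volume : Measure ((Fin d → ℝ) ×
      (Fin m → Fin d → ℝ))).withDensity
        fun p => kdens d σ μ n p.1 * ∏ j, kdens d σ μ n (p.2 j) := by
    rw [tensMeasure, pi_withDensity_eq hk, ← volume_pi, prod_withDensity hk hpi]
    rfl
  have hmeas : Measurable fun p : (Fin d → ℝ) × (Fin m → Fin d → ℝ) =>
      kdens d σ μ n p.1 * ∏ j, kdens d σ μ n (p.2 j) :=
    (hk.comp measurable_fst).mul (hpi.comp measurable_snd)
  rw [hdens, integral_withDensity_eq_integral_toReal_smul hmeas ?_, tensConv,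
    ← integral_sub_left_eq_self _ volume z]
  · refine integral_congr_ae (ae_of_all _ fun p => ?_)
    simp [kdR, Function.uncurry, ENNReal.toReal_prod]
  · have h1 : ∀ᵐ p : (Fin d → ℝ) × (Fin m → Fin d → ℝ), kdens d σ μ n p.1 < ⊤ :=
      Measure.quasiMeasurePreserving_fst.ae hfin
    have hy : ∀ᵐ y : Fin m → Fin d → ℝ, ∀ j, kdens d σ μ n (y j) < ⊤ :=
      ae_all_iff.2 fun j =>
        (Measure.quasiMeasurePreserving_eval
          (fun _ : Fin m => (volume : Measure (Fin d → ℝ))) j).ae hfin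
    have h2 : ∀ᵐ p : (Fin d → ℝ) × (Fin m → Fin d → ℝ), ∀ j, kdens d σ μ n (p.2 j) < ⊤ :=
      Measure.quasiMeasurePreserving_snd.ae hy
    filter_upwards [h1, h2] with p hp1 hp2
    exact ENNReal.mul_lt_top hp1 (ENNReal.prod_lt_top fun j _ => hp2 j)

end Densities

section Multiplier

variable {d : ℕ} {ι κ E : Type*} [NormedAddCommGroup E] [NormedSpace ℝ E] [MeasurableSpace E]
  [BorelSpace E] [SecondCountableTopology E]

lemma dualSq_add_smul (c : ℝ) (p q : StrongDual ℝ (Fin d → ℝ)) :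
    dualSq (p + c • q) =
      dualSq p + 2 * c * ∑ i, p (Pi.single i 1) * q (Pi.single i 1) + c ^ 2 * dualSq q := by
  simp only [dualSq, add_apply, smul_apply, smul_eq_mul,
    Finset.mul_sum, ← Finset.sum_add_distrib]
  exact Finset.sum_congr rfl fun i _ => by ring

open Classical in
/-- The functionals `L ∘ A₀ + c ∑_{j ∈ s} L ∘ A_j` and their squares are, after multiplication
by the resolvent symbols of all the `L ∘ A_j`, uniformly Fourier–Stieltjes. -/
lemma uniformFourierStieltjes_sum (A₀ : ι → (Fin d → ℝ) →L[ℝ] E)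
    (A : κ → ι → (Fin d → ℝ) →L[ℝ] E) (c : ι → ℝ) (hc : ∀ i, |c i| ≤ 1) (s : Finset κ) :
    UniformFourierStieltjes (fun i (L : StrongDual ℝ E) =>
      resolventSymbol (L.comp (A₀ i)) * ∏ j ∈ s, resolventSymbol (L.comp (A j i))) ∧
    (∀ k, UniformFourierStieltjes (fun i (L : StrongDual ℝ E) =>
      Complex.I * (L.comp (A₀ i) + c i • ∑ j ∈ s, L.comp (A j i)) (Pi.single k 1) *
        (resolventSymbol (L.comp (A₀ i)) * ∏ j ∈ s, resolventSymbol (L.comp (A j i))))) ∧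
    UniformFourierStieltjes (fun i (L : StrongDual ℝ E) =>
      (dualSq (L.comp (A₀ i) + c i • ∑ j ∈ s, L.comp (A j i)) : ℂ) *
        (resolventSymbol (L.comp (A₀ i)) * ∏ j ∈ s, resolventSymbol (L.comp (A j i)))) := by
  induction s using Finset.induction_on with
  | empty =>
    simp only [Finset.sum_empty, smul_zero, add_zero, Finset.prod_empty, mul_one]
    exact ⟨uniformFourierStieltjes_resolventSymbol.comp A₀,
      fun k => (uniformFourierStieltjes_deriv k).comp A₀, uniformFourierStieltjes_dualSq.comp A₀⟩
  | insert j s hj ih =>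
    obtain ⟨h0, h1, h2⟩ := ih
    have g0 := uniformFourierStieltjes_resolventSymbol.comp (A j)
    have g1 := fun k => (uniformFourierStieltjes_deriv k).comp (A j)
    have g2 := uniformFourierStieltjes_dualSq.comp (A j)
    refine ⟨?_, fun k => ?_, ?_⟩
    · convert h0.mul g0 using 3 with i L
      rw [Finset.prod_insert hj]
      ring
    · convert ((h1 k).mul g0).add ((h0.mul (g1 k)).const_mul c 1 hc) using 3 with i L
      rw [Finset.prod_insert hj, Finset.sum_insert hj, smul_add]
      simp only [add_apply, smul_apply, smul_eq_mul]
      push_cast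
      ring
    · have hc' : ∀ i, |-2 * c i| ≤ (2 : NNReal) := fun i => by
        rw [abs_mul]; norm_num; linarith [hc i]
      have hc2 : ∀ i, |c i ^ 2| ≤ (1 : NNReal) := fun i => by
        rw [abs_pow]; simpa using hc i
      convert ((h2.mul g0).add ((UniformFourierStieltjes.finset_sum Finset.univ
        fun k => (h1 k).mul (g1 k)).const_mul _ 2 hc')).add
        ((h0.mul g2).const_mul _ 1 hc2) using 3 with i L
      rw [Finset.prod_insert hj, Finset.sum_insert hj, smul_add, add_left_comm, add_comm,
        dualSq_add_smul, Finset.mul_sum]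
      have hsum : ∀ (x y : StrongDual ℝ (Fin d → ℝ)) (F G : ℂ),
          ∑ k, (Complex.I * x (Pi.single k 1) * F) * (Complex.I * y (Pi.single k 1) * G) =
            -((∑ k, x (Pi.single k 1) * y (Pi.single k 1) : ℝ) : ℂ) * (F * G) := by
        intro x y F G
        push_cast
        rw [← Finset.sum_neg_distrib, Finset.sum_mul]
        refine Finset.sum_congr rfl fun k _ => ?_
        linear_combination (x (Pi.single k 1) * F * y (Pi.single k 1) * G) * Complex.I_sq
      rw [hsum, ← Finset.mul_sum]
      push_cast
      ring

/-- The symbol relating the two convolution kernels is uniformly Fourier–Stieltjes. -/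
lemma uniformFourierStieltjes_multiplier [Fintype κ] (A₀ : ι → (Fin d → ℝ) →L[ℝ] E)
    (A : κ → ι → (Fin d → ℝ) →L[ℝ] E) (τ : ι → ℝ) (hτ : ∀ i, τ i ∈ Set.Ioc (0 : ℝ) 1) (h : ℕ) :
    UniformFourierStieltjes (fun i (L : StrongDual ℝ E) =>
      ((1 + dualSq (L.comp (A₀ i) + (1 - τ i) • ∑ j, L.comp (A j i)) : ℝ) *
        (resolventSymbol (L.comp (A₀ i)) * ∏ j, resolventSymbol (L.comp (A j i))) *
        (resolventSymbol (L.comp (A₀ i)) *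
          ∏ j, (1 + dualSq (τ i • L.comp (A j i)) : ℝ) * resolventSymbol (L.comp (A j i)))) ^ h) := by
  have hc : ∀ i, |1 - τ i| ≤ 1 := fun i => by
    obtain ⟨h0, h1⟩ := hτ i
    rw [abs_of_nonneg] <;> linarith
  have hτ2 : ∀ i, |τ i ^ 2| ≤ (1 : NNReal) := fun i => by
    obtain ⟨h0, h1⟩ := hτ i
    rw [abs_of_nonneg (sq_nonneg _)]
    exact pow_le_one₀ h0.le h1
  obtain ⟨h0, -, h2⟩ := uniformFourierStieltjes_sum A₀ A _ hc Finset.univ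
  have hy : ∀ j, UniformFourierStieltjes (fun i (L : StrongDual ℝ E) =>
      (1 + dualSq (τ i • L.comp (A j i)) : ℝ) * resolventSymbol (L.comp (A j i))) := fun j => by
    convert (uniformFourierStieltjes_resolventSymbol.comp (A j)).add
      ((uniformFourierStieltjes_dualSq.comp (A j)).const_mul _ 1 hτ2) using 3 with i L
    rw [dualSq_smul]
    push_cast
    ring
  refine UniformFourierStieltjes.pow ?_ h
  convert (h0.add h2).mul ((uniformFourierStieltjes_resolventSymbol.comp A₀).mul
    (UniformFourierStieltjes.finset_prod Finset.univ hy)) using 3 with i L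
  push_cast
  ring

end Multiplier

section TensorMeasure

variable {d m : ℕ} {σ μ : ℝ}

/-- The embedding of the `j`-th of the last `m` arguments. -/
noncomputable def inrSingle (d m : ℕ) (j : Fin m) :
    (Fin d → ℝ) →L[ℝ] (Fin d → ℝ) × (Fin m → Fin d → ℝ) :=
  (ContinuousLinearMap.inr ℝ (Fin d → ℝ) (Fin m → Fin d → ℝ)).comp
    (ContinuousLinearMap.single ℝ (fun _ : Fin m => Fin d → ℝ) j)

lemma charFunDual_tensMeasure (hμ : 0 < μ) (n : ℕ)
    (L : StrongDual ℝ ((Fin d → ℝ) × (Fin m → Fin d → ℝ))) :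
    charFunDual (tensMeasure d σ μ n m) L =
      (resolventSymbol (√(μ ^ ((2 : ℝ) / σ)) • L.comp (ContinuousLinearMap.inl ℝ _ _)) *
        ∏ j, resolventSymbol (√(μ ^ ((2 : ℝ) / σ)) • L.comp (inrSingle d m j))) ^ (n + 1) := by
  have := isProbabilityMeasure_withDensity_kdens (d := d) (σ := σ) hμ n
  rw [tensMeasure, charFunDual_prod, charFunDual_pi, charFunDual_withDensity_kdens hμ, mul_pow,
    ← Finset.prod_pow]
  simp only [charFunDual_withDensity_kdens hμ]
  rfl

/-- The linear map `(p, q) ↦ (p, p + τ (q - p))`, inverse to the change of variables in `Zresc`. -/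
noncomputable def contractMap (d m : ℕ) (τ : ℝ) :
    (Fin d → ℝ) × (Fin m → Fin d → ℝ) →L[ℝ] (Fin d → ℝ) × (Fin m → Fin d → ℝ) :=
  (ContinuousLinearMap.fst ℝ _ _).prod (ContinuousLinearMap.pi fun j =>
    (1 - τ) • ContinuousLinearMap.fst ℝ _ _ +
      τ • (ContinuousLinearMap.proj j).comp (ContinuousLinearMap.snd ℝ _ _))

lemma comp_contractMap_inl (τ : ℝ) (L : StrongDual ℝ ((Fin d → ℝ) × (Fin m → Fin d → ℝ))) :
    (L.comp (contractMap d m τ)).comp (ContinuousLinearMap.inl ℝ _ _) =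
      L.comp (ContinuousLinearMap.inl ℝ _ _) + (1 - τ) • ∑ j, L.comp (inrSingle d m j) := by
  ext x
  have h : contractMap d m τ (x, 0) = (x, 0) + (1 - τ) • ∑ j, inrSingle d m j x := by
    refine Prod.ext ?_ (funext fun j => ?_)
    · simp [contractMap, inrSingle, Prod.fst_sum]
    · simp [contractMap, inrSingle, Prod.snd_sum, Finset.sum_apply, Finset.sum_pi_single]
  simp [h]

lemma comp_contractMap_inrSingle (τ : ℝ) (j : Fin m)
    (L : StrongDual ℝ ((Fin d → ℝ) × (Fin m → Fin d → ℝ))) :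
    (L.comp (contractMap d m τ)).comp (inrSingle d m j) = τ • L.comp (inrSingle d m j) := by
  ext x
  have h : contractMap d m τ (inrSingle d m j x) = τ • inrSingle d m j x := by
    refine Prod.ext ?_ (funext fun k => ?_)
    · simp [contractMap, inrSingle]
    · simp [contractMap, inrSingle]
  simp [h]

/-- The convolution kernel of order `2h` is, up to a signed measure of uniformly bounded mass,
the convolution kernel of order `h` contracted by `contractMap`. -/
lemma exists_tensMeasure_add_conv_eq (d m : ℕ) (σ : ℝ) (n : ℕ) :
    ∃ C : NNReal, ∀ τ ∈ Set.Ioc (0 : ℝ) 1, ∀ μ : ℝ, 0 < μ →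
      ∃ M N : Measure ((Fin d → ℝ) × (Fin m → Fin d → ℝ)),
        IsFiniteMeasure M ∧ IsFiniteMeasure N ∧ M Set.univ + N Set.univ ≤ C ∧
        tensMeasure d σ μ (2 * n + 1) m + N ∗ (tensMeasure d σ μ n m).map (contractMap d m τ) =
          M ∗ (tensMeasure d σ μ n m).map (contractMap d m τ) := by
  obtain ⟨C, hC⟩ := uniformFourierStieltjes_multiplier
    (ι := ℝ × {τ : ℝ // τ ∈ Set.Ioc (0 : ℝ) 1})
    (fun i => i.1 • ContinuousLinearMap.inl ℝ (Fin d → ℝ) (Fin m → Fin d → ℝ))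
    (fun (j : Fin m) i => i.1 • inrSingle d m j) (fun i => i.2.1) (fun i => i.2.2) (n + 1)
  refine ⟨C, fun τ hτ μ hμ => ?_⟩
  obtain ⟨M, N, hM, hN, hMN, h⟩ := hC (√(μ ^ ((2 : ℝ) / σ)), ⟨τ, hτ⟩)
  refine ⟨M, N, hM, hN, hMN, ?_⟩
  have h1 := isProbabilityMeasure_tensMeasure (d := d) (σ := σ) hμ n m
  have h2 := isProbabilityMeasure_tensMeasure (d := d) (σ := σ) hμ (2 * n + 1) m
  refine Measure.ext_of_charFunDual (funext fun L => ?_)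
  rw [charFunDual_add_measure, charFunDual_conv, charFunDual_conv, charFunDual_map,
    ← eq_sub_iff_add_eq, ← sub_mul, ← h L, charFunDual_tensMeasure hμ, charFunDual_tensMeasure hμ]
  simp only [ContinuousLinearMap.comp_smul, comp_contractMap_inl, comp_contractMap_inrSingle]
  generalize √(μ ^ ((2 : ℝ) / σ)) = s
  generalize L.comp (ContinuousLinearMap.inl ℝ (Fin d → ℝ) (Fin m → Fin d → ℝ)) = x
  generalize hy : (fun j => L.comp (inrSingle d m j)) = y
  simp only [funext_iff] at hy
  simp only [hy]
  have key : ∀ q : StrongDual ℝ (Fin d → ℝ), ((1 + dualSq q : ℝ) : ℂ) * resolventSymbol q = 1 :=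
    fun q => mul_inv_cancel₀ (one_add_dualSq_ne_zero q)
  have e1 : s • x + (1 - τ) • ∑ j, s • y j = s • (x + (1 - τ) • ∑ j, y j) := by
    rw [smul_add, Finset.smul_sum, Finset.smul_sum, Finset.smul_sum]
    congr 1
    exact Finset.sum_congr rfl fun j _ => smul_comm _ _ _
  rw [e1, ← mul_pow, show 2 * n + 1 + 1 = 2 * (n + 1) by ring, pow_mul]
  congr 1
  simp only [smul_comm τ s, Finset.prod_mul_distrib]
  have e2 : (∏ j, ((1 + dualSq (s • τ • y j) : ℝ) : ℂ)) * ∏ j, resolventSymbol (s • τ • y j) = 1 := by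
    rw [← Finset.prod_mul_distrib]
    exact Finset.prod_eq_one fun j _ => key _
  have e3 := key (s • (x + (1 - τ) • ∑ j, y j))
  generalize (∏ j, ((1 + dualSq (s • τ • y j) : ℝ) : ℂ)) = a at e2 ⊢
  generalize ∏ j, resolventSymbol (s • τ • y j) = b at e2 ⊢
  linear_combination (-(resolventSymbol (s • x) * ∏ j, resolventSymbol (s • y j)) ^ 2) *
    (a * b * e3 + e2)

end TensorMeasure

section Young

variable {d m : ℕ} {σ μ τ : ℝ}

lemma lintegral_lintegral_sub_le {f : (Fin d → ℝ) × (Fin m → Fin d → ℝ) → ℝ≥0∞} (hf : Measurable f)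
    (ν : Measure ((Fin d → ℝ) × (Fin m → Fin d → ℝ))) [SFinite ν] (x : Fin d → ℝ) :
    ∫⁻ y, ∫⁻ p, f ((x, y) - p) ∂ν ≤ ν Set.univ * ⨆ x, ∫⁻ y, f (x, y) := by
  rw [lintegral_lintegral_swap (by fun_prop)]
  calc ∫⁻ p, (∫⁻ y, f ((x, y) - p)) ∂ν = ∫⁻ p, (∫⁻ y, f (x - p.1, y)) ∂ν :=
        lintegral_congr fun p => lintegral_sub_right_eq_self (fun y => f (x - p.1, y)) p.2
    _ ≤ ∫⁻ _, (⨆ x, ∫⁻ y, f (x, y)) ∂ν :=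
        lintegral_mono fun p => le_iSup (fun x => ∫⁻ y, f (x, y)) (x - p.1)
    _ = _ := by rw [lintegral_const, mul_comm]

lemma ae_integrable_comp_sub {V : (Fin d → ℝ) → (Fin m → Fin d → ℝ) → ℝ}
    (hV : Measurable (Function.uncurry V)) (hfin : Vnorm d m V < ⊤)
    (ν : Measure ((Fin d → ℝ) × (Fin m → Fin d → ℝ))) [IsFiniteMeasure ν] (x : Fin d → ℝ) :
    ∀ᵐ y, Integrable (fun p => Function.uncurry V ((x, y) - p)) ν := by
  have h := lintegral_lintegral_sub_le hV.enorm ν x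
  have hlt : ∫⁻ y, ∫⁻ p, ‖Function.uncurry V ((x, y) - p)‖ₑ ∂ν < ⊤ :=
    h.trans_lt (ENNReal.mul_lt_top (measure_lt_top ν _) hfin)
  have hm : Measurable fun y : Fin m → Fin d → ℝ =>
      ∫⁻ p, ‖Function.uncurry V ((x, y) - p)‖ₑ ∂ν :=
    Measurable.lintegral_prod_right' (f := fun q : (Fin m → Fin d → ℝ) ×
      ((Fin d → ℝ) × (Fin m → Fin d → ℝ)) => ‖Function.uncurry V ((x, q.1) - q.2)‖ₑ) (by fun_prop)
  filter_upwards [ae_lt_top hm hlt.ne] with y hy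
  exact ⟨(by fun_prop : Measurable fun p => Function.uncurry V ((x, y) - p)).aestronglyMeasurable,
    hy⟩

/-- The change of variables in `Zresc`. -/
noncomputable def expandMap (d m : ℕ) (τ : ℝ) (z : (Fin d → ℝ) × (Fin m → Fin d → ℝ)) :
    (Fin d → ℝ) × (Fin m → Fin d → ℝ) :=
  (z.1, fun j i => z.1 i + (z.2 j i - z.1 i) / τ)

lemma continuous_expandMap : Continuous (expandMap d m τ) := by
  unfold expandMap
  fun_prop

lemma uncurry_Zresc (V : (Fin d → ℝ) → (Fin m → Fin d → ℝ) → ℝ) :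
    Function.uncurry (Zresc d m τ V) =
      fun z => τ ^ (-((d * m : ℕ) : ℝ)) * Function.uncurry V (expandMap d m τ z) := rfl

lemma expandMap_sub_contractMap (hτ : τ ≠ 0) (z p : (Fin d → ℝ) × (Fin m → Fin d → ℝ)) :
    expandMap d m τ (z - contractMap d m τ p) = expandMap d m τ z - p := by
  refine Prod.ext ?_ (funext fun j => funext fun i => ?_)
  · simp [expandMap, contractMap]
  · simp only [expandMap, contractMap, ContinuousLinearMap.prod_apply, Prod.fst_sub, Prod.snd_sub,
      Pi.sub_apply, ContinuousLinearMap.coe_fst', ContinuousLinearMap.coe_pi', add_apply,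
      smul_apply, Pi.add_apply, Pi.smul_apply, smul_eq_mul, ContinuousLinearMap.comp_apply,
      ContinuousLinearMap.coe_snd', ContinuousLinearMap.proj_apply]
    field_simp
    ring

lemma Zresc_tensConv (hμ : 0 < μ) (hτ : τ ≠ 0) (n : ℕ)
    {V : (Fin d → ℝ) → (Fin m → Fin d → ℝ) → ℝ} (hV : Measurable (Function.uncurry V))
    (z : (Fin d → ℝ) × (Fin m → Fin d → ℝ)) :
    Function.uncurry (Zresc d m τ (tensConv d σ μ (n + 1) m V)) z =
      ∫ p, Function.uncurry (Zresc d m τ V) (z - p)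
        ∂(tensMeasure d σ μ n m).map (contractMap d m τ) := by
  have hS := (continuous_expandMap (d := d) (m := m) (τ := τ)).measurable
  rw [integral_map (contractMap d m τ).continuous.aemeasurable
    (by simp only [uncurry_Zresc]; exact Measurable.aestronglyMeasurable (by fun_prop))]
  simp only [uncurry_Zresc, expandMap_sub_contractMap hτ]
  rw [integral_const_mul, ← tensConv_eq_integral hμ]
  rfl

lemma measurable_tensConv (hμ : 0 < μ) (n : ℕ)
    {V : (Fin d → ℝ) → (Fin m → Fin d → ℝ) → ℝ} (hV : Measurable (Function.uncurry V)) :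
    Measurable (Function.uncurry (tensConv d σ μ (n + 1) m V)) := by
  have := isProbabilityMeasure_tensMeasure (d := d) (σ := σ) hμ n m
  have h : Function.uncurry (tensConv d σ μ (n + 1) m V) =
      fun z => ∫ p, Function.uncurry V (z - p) ∂tensMeasure d σ μ n m :=
    funext fun z => tensConv_eq_integral hμ V z
  rw [h]
  exact ((by fun_prop : Measurable fun q : ((Fin d → ℝ) × (Fin m → Fin d → ℝ)) ×
    ((Fin d → ℝ) × (Fin m → Fin d → ℝ)) =>
      Function.uncurry V (q.1 - q.2)).stronglyMeasurable.integral_prod_right').measurable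

lemma measurable_Zresc {V : (Fin d → ℝ) → (Fin m → Fin d → ℝ) → ℝ}
    (hV : Measurable (Function.uncurry V)) : Measurable (Function.uncurry (Zresc d m τ V)) := by
  have hS := (continuous_expandMap (d := d) (m := m) (τ := τ)).measurable
  rw [uncurry_Zresc]
  fun_prop

lemma Vnorm_Zresc_le (hτ : 0 < τ) {V : (Fin d → ℝ) → (Fin m → Fin d → ℝ) → ℝ}
    (hV : Measurable (Function.uncurry V)) : Vnorm d m (Zresc d m τ V) ≤ Vnorm d m V := by
  refine iSup_mono fun x => le_of_eq ?_
  have hVx : Measurable (V x) := hV.comp measurable_prodMk_left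
  set x' : Fin m → Fin d → ℝ := fun _ => x
  have hpt : ∀ y, (‖Zresc d m τ V x y‖₊ : ℝ≥0∞) =
      ENNReal.ofReal (τ ^ (-((d * m : ℕ) : ℝ))) * ‖V x (x' + τ⁻¹ • (y - x'))‖ₑ := fun y => by
    have hy : (fun j i => x i + (y j i - x i) / τ) = x' + τ⁻¹ • (y - x') := by
      ext j i
      simp [x', div_eq_inv_mul]
    rw [← enorm_eq_nnnorm, Zresc, hy, enorm_mul, Real.enorm_of_nonneg (by positivity)]
  simp only [hpt]
  rw [lintegral_const_mul _ (by fun_prop),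
    lintegral_sub_right_eq_self (fun y => ‖V x (x' + τ⁻¹ • y)‖ₑ) x',
    ← lintegral_map (f := fun y => ‖V x (x' + y)‖ₑ) (by fun_prop)
      (by fun_prop : Measurable fun y : Fin m → Fin d → ℝ => τ⁻¹ • y),
    Measure.map_addHaar_smul _ (inv_ne_zero hτ.ne'), lintegral_smul_measure,
    lintegral_add_left_eq_self (fun y => ‖V x y‖ₑ) x', smul_eq_mul, ← mul_assoc,
    ← ENNReal.ofReal_mul (by positivity)]
  have hone : τ ^ (-((d * m : ℕ) : ℝ)) * |((τ⁻¹ ^ Module.finrank ℝ (Fin m → Fin d → ℝ))⁻¹)| = 1 := by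
    have hr : Module.finrank ℝ (Fin m → Fin d → ℝ) = d * m := by
      simp [Module.finrank_pi_fintype, mul_comm]
    rw [hr, inv_pow, inv_inv, abs_of_pos (by positivity), Real.rpow_neg hτ.le, Real.rpow_natCast,
      inv_mul_cancel₀ (by positivity)]
  rw [hone, ENNReal.ofReal_one, one_mul]
  rfl

lemma Vnorm_tensConv_Zresc_le (hμ : 0 < μ) (hτ : 0 < τ) (n k : ℕ)
    {V : (Fin d → ℝ) → (Fin m → Fin d → ℝ) → ℝ} (hV : Measurable (Function.uncurry V))
    (hfin : Vnorm d m V < ⊤) {M N : Measure ((Fin d → ℝ) × (Fin m → Fin d → ℝ))}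
    [IsFiniteMeasure M] [IsFiniteMeasure N]
    (h : tensMeasure d σ μ k m + N ∗ (tensMeasure d σ μ n m).map (contractMap d m τ) =
      M ∗ (tensMeasure d σ μ n m).map (contractMap d m τ)) :
    Vnorm d m (tensConv d σ μ (k + 1) m (Zresc d m τ V)) ≤
      (M Set.univ + N Set.univ) * Vnorm d m (tensConv d σ μ (n + 1) m V) := by
  have hn := isProbabilityMeasure_tensMeasure (d := d) (σ := σ) hμ n m
  have hk := isProbabilityMeasure_tensMeasure (d := d) (σ := σ) hμ k m
  set G := (tensMeasure d σ μ n m).map (contractMap d m τ)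
  set U := Zresc d m τ V
  set W := Zresc d m τ (tensConv d σ μ (n + 1) m V)
  have hU : Measurable (Function.uncurry U) := measurable_Zresc hV
  have hW : Measurable (Function.uncurry W) := measurable_Zresc (measurable_tensConv hμ n hV)
  have hUfin : Vnorm d m U < ⊤ := (Vnorm_Zresc_le hτ hV).trans_lt hfin
  have hconv : ∀ (P : Measure ((Fin d → ℝ) × (Fin m → Fin d → ℝ))) [IsFiniteMeasure P] z,
      Integrable (fun p => Function.uncurry U (z - p)) (P ∗ G) →
      ∫ p, Function.uncurry U (z - p) ∂(P ∗ G) = ∫ p, Function.uncurry W (z - p) ∂P :=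
    fun P _ z hi => by
      rw [integral_conv hi]
      refine integral_congr_ae (ae_of_all _ fun a => ?_)
      simp only [← sub_sub]
      exact (Zresc_tensConv hμ hτ.ne' n hV _).symm
  calc Vnorm d m (tensConv d σ μ (k + 1) m U)
      ≤ (M Set.univ + N Set.univ) * Vnorm d m W := by
        refine iSup_le fun x => ?_
        refine le_trans (lintegral_mono_ae ?_) (lintegral_lintegral_sub_le hW.enorm (M + N) x)
        filter_upwards [ae_integrable_comp_sub hU hUfin (tensMeasure d σ μ k m) x,
          ae_integrable_comp_sub hU hUfin (M ∗ G) x,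
          ae_integrable_comp_sub hU hUfin (N ∗ G) x] with y hy hyM hyN
        have hz := integral_add_measure hy hyN
        rw [h, hconv M _ hyM, hconv N _ hyN, ← tensConv_eq_integral hμ, ← sub_eq_iff_eq_add] at hz
        rw [← enorm_eq_nnnorm, lintegral_add_measure]
        simp only at hz
        rw [← hz]
        exact enorm_sub_le.trans (add_le_add (enorm_integral_le_lintegral_enorm _)
          (enorm_integral_le_lintegral_enorm _))
    _ ≤ _ := by
        gcongr
        exact Vnorm_Zresc_le hτ (measurable_tensConv hμ n hV)

end Young

/-- for `h ≥ 1`, `m ∈ ℕ` there is `C = C(d,σ,h,m) > 0` such that for all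
`τ, μ ∈ (0,1]` and every continuous `V` with finite `𝒱^m` norm,
`‖K_μ^{*2h,⊗(1+m)} ∗ 𝐙_τ V‖_{𝒱^m} ≤ C ‖K_μ^{*h,⊗(1+m)} ∗ V‖_{𝒱^m}`. -/
theorem stmt13 (d : ℕ) (hd : 1 ≤ d) (σ : ℝ) (hσ : 0 < σ) (h : ℕ) (hh : 1 ≤ h) (m : ℕ) :
    ∃ C : ℝ, 0 < C ∧ ∀ τ μ : ℝ, τ ∈ Set.Ioc (0 : ℝ) 1 → μ ∈ Set.Ioc (0 : ℝ) 1 →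
      ∀ V : (Fin d → ℝ) → (Fin m → Fin d → ℝ) → ℝ,
        Continuous (Function.uncurry V) → Vnorm d m V < ⊤ →
        Vnorm d m (tensConv d σ μ (2 * h) m (Zresc d m τ V)) ≤
          ENNReal.ofReal C * Vnorm d m (tensConv d σ μ h m V) := by
  obtain ⟨n, rfl⟩ : ∃ n, h = n + 1 := ⟨h - 1, by omega⟩
  obtain ⟨C, hC⟩ := exists_tensMeasure_add_conv_eq d m σ n
  refine ⟨C + 1, by positivity, fun τ μ hτ hμ V hV hfin => ?_⟩
  obtain ⟨M, N, _, _, hMN, hEq⟩ := hC τ hτ μ hμ.1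
  refine (Vnorm_tensConv_Zresc_le hμ.1 hτ.1 n (2 * n + 1) hV.measurable hfin hEq).trans ?_
  gcongr
  refine hMN.trans ?_
  rw [← ENNReal.ofReal_coe_nnreal]
  exact ENNReal.ofReal_le_ofReal (by linarith)
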